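/- Let K be a field, S = K[x_1,…,x_n], let I ⊆ S be the ideal generated by the variables x_1,…,x_r (for some 1 ≤ r ≤ n) together with some squarefree monomials of degrees ≥ 2, and let J ⊂ I be a squarefree monomial ideal generated in degrees ≥ 2. Assume x_i x_t x_k ∈ J for all i ∈ {1,…,r} and all r < t < k ≤ n. Then depth_S I/J ≤ 2. -/

import Mathlib

open MvPolynomial

/-- The squarefree monomial with support `T` in `K[x_0,…,x_{n-1}]`. -/
noncomputable def sqf (K : Type*) [Field K] (n : ℕ) (T : Finset (Fin n)) :
    MvPolynomial (Fin n) K :=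
  ∏ i ∈ T, X i

/-- The poset `P_{I\J}`: supports of squarefree monomials lying in `I \ J`. -/
def sqfPoset (K : Type*) [Field K] (n : ℕ) (I J : Ideal (MvPolynomial (Fin n) K)) :
    Set (Finset (Fin n)) :=
  {T | sqf K n T ∈ I ∧ sqf K n T ∉ J}

/-- Supports of squarefree monomials of degree `d` lying in `I \ J`. -/
def degSet (K : Type*) [Field K] (n : ℕ) (I J : Ideal (MvPolynomial (Fin n) K)) (d : ℕ) :
    Set (Finset (Fin n)) :=
  {T | T.card = d ∧ T ∈ sqfPoset K n I J}

/-- A partition of a set `P` of supports of squarefree monomials into intervals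
`[u,v] = {w : u ⊆ w ⊆ v}`. -/
structure SqfPartition (n : ℕ) (P : Set (Finset (Fin n))) where
  intervals : Finset (Finset (Fin n) × Finset (Fin n))
  le : ∀ p ∈ intervals, p.1 ⊆ p.2
  ends : ∀ p ∈ intervals, p.1 ∈ P ∧ p.2 ∈ P
  covers : ∀ T ∈ P, ∃ p ∈ intervals, p.1 ⊆ T ∧ T ⊆ p.2
  disj : ∀ p ∈ intervals, ∀ q ∈ intervals, ∀ T : Finset (Fin n),
    p.1 ⊆ T → T ⊆ p.2 → q.1 ⊆ T → T ⊆ q.2 → p = q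

/-- The Stanley depth of a partition: the minimal degree of the upper ends of
its intervals. -/
noncomputable def SqfPartition.sdepth {n : ℕ} {P : Set (Finset (Fin n))}
    (pt : SqfPartition n P) : ℕ :=
  sInf {k | ∃ p ∈ pt.intervals, p.2.card = k}

/-- The Stanley depth of `I/J`: the maximal Stanley depth of a partition of `P_{I\J}`. -/
noncomputable def stanleyDepth (K : Type*) [Field K] (n : ℕ)
    (I J : Ideal (MvPolynomial (Fin n) K)) : ℕ :=
  sSup {k | ∃ pt : SqfPartition n (sqfPoset K n I J), pt.sdepth = k}

/-- The `S`-module `I/J` (for `J ⊆ I` this is the usual quotient). -/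
noncomputable abbrev quotMod (K : Type*) [Field K] (n : ℕ)
    (I J : Ideal (MvPolynomial (Fin n) K)) : Type _ :=
  I ⧸ (Submodule.comap I.subtype J)

/-- The depth of `I/J` over `S = K[x_0,…,x_{n-1}]`: the supremum of lengths of
regular sequences on `I/J` consisting of elements of the maximal graded ideal
`(x_0,…,x_{n-1})`. -/
noncomputable def mdepth (K : Type*) [Field K] (n : ℕ)
    (I J : Ideal (MvPolynomial (Fin n) K)) : ℕ :=
  sSup {k | ∃ rs : List (MvPolynomial (Fin n) K), rs.length = k ∧
    (∀ r ∈ rs, r ∈ Ideal.span (Set.range (X : Fin n → MvPolynomial (Fin n) K))) ∧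
    RingTheory.Sequence.IsRegular (quotMod K n I J) rs}

open RingTheory.Sequence
open scoped Pointwise

section KoszulCocycles

variable {R M : Type*} [CommRing R] [AddCommGroup M] [Module R M]

/-- A function that behaves on the ideal `P` like a Koszul `1`-cocycle with values in `M`. -/
def IsCocycleOn (P : Ideal R) (φ : R → M) : Prop :=
  ∀ p ∈ P, ∀ q ∈ P, p • φ q = q • φ p

/-- Over an ideal containing an `M`-regular sequence of length two, cocycles are coboundaries. -/
theorem IsCocycleOn.exists_eq_smul {P : Ideal R} {φ : R → M} (hφ : IsCocycleOn P φ)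
    {a b : R} {rs : List R} (ha : a ∈ P) (hb : b ∈ P)
    (hreg : IsWeaklyRegular M (a :: b :: rs)) :
    ∃ z : M, ∀ p ∈ P, φ p = p • z := by
  rw [isWeaklyRegular_cons_iff, isWeaklyRegular_cons_iff] at hreg
  obtain ⟨hrega, hregb, -⟩ := hreg
  have hmem : φ a ∈ a • (⊤ : Submodule R M) := by
    have h0 : b • (Submodule.Quotient.mk (φ a) : QuotSMulTop a M) = 0 := by
      rw [← Submodule.Quotient.mk_smul, Submodule.Quotient.mk_eq_zero, hφ b hb a ha]
      exact Submodule.smul_mem_pointwise_smul _ _ _ trivial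
    rw [← Submodule.Quotient.mk_eq_zero]
    exact hregb (h0.trans (smul_zero b).symm)
  obtain ⟨z, -, hz⟩ := (Submodule.mem_smul_pointwise_iff_exists _ _ _).1 hmem
  refine ⟨z, fun p hp => hrega ?_⟩
  change a • φ p = a • p • z
  rw [hφ a ha p hp, ← hz, smul_comm]

/-- If `P + (x)` contains an `M`-regular sequence of length three, then multiplication by `x` is
surjective on cocycles over `P` modulo coboundaries. -/
theorem IsCocycleOn.exists_eq_smul_sub {P : Ideal R} {φ : R → M} (hφ : IsCocycleOn P φ)
    {x a b c : R} {rs : List R} (ha : a ∈ P ⊔ Ideal.span {x}) (hb : b ∈ P ⊔ Ideal.span {x})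
    (hc : c ∈ P ⊔ Ideal.span {x}) (hreg : IsWeaklyRegular M (a :: b :: c :: rs)) :
    ∃ (ψ : R → M) (w : M), IsCocycleOn P ψ ∧ ∀ p ∈ P, φ p = p • w - x • ψ p := by
  rw [isWeaklyRegular_cons_iff] at hreg
  obtain ⟨hrega, hreg⟩ := hreg
  have hdecomp : ∀ y : R, ∃ p s : R, y ∈ P ⊔ Ideal.span {x} → p ∈ P ∧ y = p + x * s := by
    intro y
    by_cases hy : y ∈ P ⊔ Ideal.span {x}
    · obtain ⟨p, hp, q, hq, rfl⟩ := Submodule.mem_sup.1 hy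
      obtain ⟨s, rfl⟩ := Ideal.mem_span_singleton.1 hq
      exact ⟨p, s, fun _ => ⟨hp, rfl⟩⟩
    · exact ⟨0, 0, fun h => absurd h hy⟩
  choose f g hfg using hdecomp
  obtain ⟨ha', hae⟩ := hfg a ha
  set a' := f a
  set α := g a
  have hcong : ∀ p ∈ P, ∀ s, ∀ p' ∈ P, ∀ s',
      (p + x * s) • (s' • φ a' - α • φ p') - (p' + x * s') • (s • φ a' - α • φ p)
        = a • (s' • φ p - s • φ p') := by
    intro p hp s p' hp' s'
    have h1 := hφ p hp p' hp'
    have h2 := hφ p hp a' ha'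
    have h3 := hφ p' hp' a' ha'
    rw [hae]
    linear_combination (norm := module) s' • h2 - s • h3 - α • h1
  have hχ : IsCocycleOn (P ⊔ Ideal.span {x})
      (fun y => (Submodule.Quotient.mk (g y • φ a' - α • φ (f y)) : QuotSMulTop a M)) := by
    intro y hy y' hy'
    obtain ⟨hp, he⟩ := hfg y hy
    obtain ⟨hp', he'⟩ := hfg y' hy'
    change y • Submodule.Quotient.mk _ = y' • Submodule.Quotient.mk _
    rw [← Submodule.Quotient.mk_smul, ← Submodule.Quotient.mk_smul, Submodule.Quotient.eq]
    have := hcong _ hp (g y) _ hp' (g y')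
    rw [← he, ← he'] at this
    rw [this]
    exact Submodule.smul_mem_pointwise_smul _ _ _ trivial
  obtain ⟨z, hz⟩ := hχ.exists_eq_smul hb hc hreg
  obtain ⟨z, rfl⟩ := Submodule.Quotient.mk_surjective _ z
  have hval : ∀ p ∈ P, ∀ s, ∃ v : M, s • φ a' - α • φ p - (p + x * s) • z = a • v := by
    intro p hp s
    obtain ⟨hq, hbe⟩ := hfg b hb
    have hmk : (Submodule.Quotient.mk (s • φ a' - α • φ p) : QuotSMulTop a M)
        = (p + x * s) • Submodule.Quotient.mk z := by
      refine ((isWeaklyRegular_cons_iff _ _ _).1 hreg).1 ?_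
      change b • Submodule.Quotient.mk _ = b • _ • Submodule.Quotient.mk z
      rw [smul_comm b, ← hz b hb, ← Submodule.Quotient.mk_smul, ← Submodule.Quotient.mk_smul,
        Submodule.Quotient.eq]
      have := hcong _ hq (g b) p hp s
      rw [← hbe] at this
      rw [this]
      exact Submodule.smul_mem_pointwise_smul _ _ _ trivial
    rw [← Submodule.Quotient.mk_smul, Submodule.Quotient.eq] at hmk
    obtain ⟨v, -, hv⟩ := (Submodule.mem_smul_pointwise_iff_exists _ _ _).1 hmk
    exact ⟨v, hv.symm⟩
  have hψ : ∀ p, ∃ v : M, p ∈ P → α • φ p + p • z = a • v := by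
    intro p
    by_cases hp : p ∈ P
    · obtain ⟨v, hv⟩ := hval p hp 0
      exact ⟨-v, fun _ => by linear_combination (norm := module) -hv⟩
    · exact ⟨0, fun h => absurd h hp⟩
  choose ψ hψ using hψ
  obtain ⟨w, hw⟩ := hval 0 P.zero_mem 1
  refine ⟨fun p => -ψ p, w + ψ 0, fun p hp q hq => hrega ?_, fun p hp => hrega ?_⟩
  · change a • p • -ψ q = a • q • -ψ p
    linear_combination (norm := module) p • hψ q hq - q • hψ p hp - α • hφ p hp q hq
  · change a • φ p = a • (p • (w + ψ 0) - x • -ψ p)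
    have h0 := hψ 0 P.zero_mem
    have h1 : a • φ p = (a' + x * α) • φ p := congrArg (· • φ p) hae
    linear_combination (norm := module)
      h1 - hφ p hp a' ha' + x • hψ p hp + p • hw + p • h0

end KoszulCocycles

section MonomialIdeals

variable {σ K : Type*} [Field K]

theorem exists_le_of_mem_span_monomial {s : Set (σ →₀ ℕ)} {f : MvPolynomial σ K}
    (hf : f ∈ Ideal.span ((fun d => monomial d (1 : K)) '' s)) {d : σ →₀ ℕ}
    (hd : coeff d f ≠ 0) : ∃ e ∈ s, e ≤ d :=
  mem_ideal_span_monomial_image.1 hf d (mem_support_iff.2 hd)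

theorem coeff_eq_zero_of_monomial_notMem {s : Set (σ →₀ ℕ)} {f : MvPolynomial σ K}
    (hf : f ∈ Ideal.span ((fun d => monomial d (1 : K)) '' s)) {d : σ →₀ ℕ}
    (hd : monomial d (1 : K) ∉ Ideal.span ((fun d => monomial d (1 : K)) '' s)) :
    coeff d f = 0 := by
  by_contra h
  obtain ⟨e, he, hle⟩ := exists_le_of_mem_span_monomial hf h
  refine hd (mem_ideal_span_monomial_image.2 fun c hc => ⟨e, he, ?_⟩)
  rwa [Finset.mem_singleton.1 (support_monomial_subset hc)]

end MonomialIdeals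

theorem sqf_eq_monomial (K : Type*) [Field K] {n : ℕ} (T : Finset (Fin n)) :
    sqf K n T = monomial (∑ i ∈ T, Finsupp.single i 1) 1 := by
  simp [sqf, X, monomial_sum_one]

/-- Let `A` and `B` be disjoint sets of variables with `u x_i x_k ∈ J` for `i ∈ A`, `k ∈ B`. Then
`x_i ↦ u x_i` for `i ∈ A` and `x_k ↦ 0` for `k ∈ B` extends to a cocycle on `(x_j : j ∈ A ∪ B)`. -/
theorem exists_isCocycleOn_quotMod {K : Type*} [Field K] {n : ℕ}
    {I J : Ideal (MvPolynomial (Fin n) K)} {A B : Set (Fin n)} (hAB : Disjoint A B)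
    (u : MvPolynomial (Fin n) K) (hA : ∀ i ∈ A, X i ∈ I)
    (hJ : ∀ i ∈ A, ∀ k ∈ B, u * X i * X k ∈ J) :
    ∃ φ : MvPolynomial (Fin n) K → quotMod K n I J,
      IsCocycleOn (Ideal.span (X '' (A ∪ B))) φ ∧
      ∀ i (hi : i ∈ A), φ (X i) = Submodule.Quotient.mk ⟨u * X i, I.mul_mem_left u (hA i hi)⟩ := by
  classical
  let ρ : MvPolynomial (Fin n) K →ₐ[K] MvPolynomial (Fin n) K :=
    aeval fun i => if i ∈ B then 0 else X i
  have hρA : ∀ i ∈ A, ρ (X i) = X i := fun i hi => by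
    simp [ρ, Set.disjoint_left.1 hAB hi]
  have hρP : ∀ p ∈ Ideal.span (X '' (A ∪ B)), ρ p ∈ Ideal.span (X '' A) := by
    intro p hp
    have hle : Ideal.span (X '' (A ∪ B)) ≤
        (Ideal.span (X '' A : Set (MvPolynomial (Fin n) K))).comap ρ := by
      rw [Ideal.span_le]
      rintro _ ⟨i, hi | hi, rfl⟩
      · change ρ (X i) ∈ Ideal.span (X '' A)
        rw [hρA i hi]
        exact Ideal.subset_span ⟨i, hi, rfl⟩
      · change ρ (X i) ∈ Ideal.span (X '' A)
        simp [ρ, hi]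
    exact hle hp
  have hρsub : ∀ p, p - ρ p ∈ Ideal.span (X '' B : Set (MvPolynomial (Fin n) K)) := by
    intro p
    induction p using MvPolynomial.induction_on with
    | C a => simp [ρ]
    | add p q hp hq =>
      rw [map_add, add_sub_add_comm]
      exact add_mem hp hq
    | mul_X p i hp =>
      by_cases hi : i ∈ B
      · have hX : X i ∈ Ideal.span (X '' B : Set (MvPolynomial (Fin n) K)) :=
          Ideal.subset_span ⟨i, hi, rfl⟩
        simpa [ρ, hi] using Ideal.mul_mem_left _ p hX
      · have : p * X i - ρ (p * X i) = (p - ρ p) * X i := by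
          simp [ρ, hi, sub_mul]
        rw [this]
        exact Ideal.mul_mem_right _ _ hp
  have hmulJ : ∀ f ∈ Ideal.span (X '' A : Set (MvPolynomial (Fin n) K)),
      ∀ g ∈ Ideal.span (X '' B : Set (MvPolynomial (Fin n) K)), u * (f * g) ∈ J := by
    intro f hf g hg
    have hle : Ideal.span (X '' A) * Ideal.span (X '' B) ≤
        Submodule.comap (LinearMap.mulLeft (MvPolynomial (Fin n) K) u) J := by
      rw [Ideal.span_mul_span', Submodule.span_le]
      rintro _ ⟨_, ⟨i, hi, rfl⟩, _, ⟨k, hk, rfl⟩, rfl⟩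
      simpa [mul_assoc] using hJ i hi k hk
    exact hle (Ideal.mul_mem_mul hf hg)
  have hAI : Ideal.span (X '' A) ≤ I := by
    rw [Ideal.span_le]
    rintro _ ⟨i, hi, rfl⟩
    exact hA i hi
  refine ⟨fun p => if h : u * ρ p ∈ I then Submodule.Quotient.mk ⟨u * ρ p, h⟩ else 0, ?_, ?_⟩
  · intro p hp q hq
    have hpI : u * ρ p ∈ I := I.mul_mem_left u (hAI (hρP p hp))
    have hqI : u * ρ q ∈ I := I.mul_mem_left u (hAI (hρP q hq))
    simp only [dif_pos hpI, dif_pos hqI]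
    rw [← Submodule.Quotient.mk_smul, ← Submodule.Quotient.mk_smul, Submodule.Quotient.eq]
    change p * (u * ρ q) - q * (u * ρ p) ∈ J
    have h := J.sub_mem (hmulJ _ (hρP q hq) _ (hρsub p)) (hmulJ _ (hρP p hp) _ (hρsub q))
    convert h using 1
    ring
  · intro i hi
    simp only [hρA i hi, dif_pos (I.mul_mem_left u (hA i hi))]

/-- **Proposition 1.3.** -/
theorem stmt9 (n : ℕ) (K : Type*) [Field K]
    (r : ℕ) (hr1 : 1 ≤ r) (hrn : r ≤ n)
    (I J : Ideal (MvPolynomial (Fin n) K))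
    (hI : ∃ F : Set (Finset (Fin n)), (∀ T ∈ F, 2 ≤ T.card) ∧
      I = Ideal.span ((X '' {i : Fin n | (i : ℕ) < r}) ∪ sqf K n '' F))
    (hJI : J < I)
    (hJ : ∃ G : Set (Finset (Fin n)), (∀ T ∈ G, 2 ≤ T.card) ∧
      J = Ideal.span (sqf K n '' G))
    (h3 : ∀ i t k : Fin n, (i : ℕ) < r → r ≤ (t : ℕ) → (t : ℕ) < (k : ℕ) →
      X i * X t * X k ∈ J) :
    mdepth K n I J ≤ 2 := by
  obtain ⟨F, hF, hI⟩ := hI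
  obtain ⟨G, hG, hJ⟩ := hJ
  let e : Finset (Fin n) → Fin n →₀ ℕ := fun T => ∑ i ∈ T, Finsupp.single i 1
  have hdeg : ∀ T, (e T).degree = T.card := fun T => by simp [e]
  have hJm : J = Ideal.span ((fun d => monomial d (1 : K)) '' (e '' G)) := by
    rw [hJ, Set.image_image]
    simp only [sqf_eq_monomial, e]
  have hIm : I = Ideal.span ((fun d => monomial d (1 : K)) ''
      ((fun i => Finsupp.single i 1) '' {i : Fin n | (i : ℕ) < r} ∪ e '' F)) := by
    rw [hI, Set.image_union, Set.image_image, Set.image_image]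
    simp only [sqf_eq_monomial, e]
    rfl
  have hXI : ∀ i : Fin n, (i : ℕ) < r → X i ∈ I := fun i hi => by
    rw [hI]
    exact Ideal.subset_span (Or.inl ⟨i, hi, rfl⟩)
  have hI0 : ∀ f ∈ I, coeff 0 f = 0 := by
    intro f hf
    by_contra h
    rw [hIm] at hf
    obtain ⟨_, ⟨i, -, rfl⟩ | ⟨T, hT, rfl⟩, hle⟩ := exists_le_of_mem_span_monomial hf h
    · simpa using Finsupp.degree_mono hle
    · have := Finsupp.degree_mono hle
      have := hF T hT
      rw [hdeg, map_zero] at *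
      omega
  have hI1 : ∀ f ∈ I, ∀ t : Fin n, r ≤ (t : ℕ) → coeff (Finsupp.single t 1) f = 0 := by
    intro f hf t ht
    by_contra h
    rw [hIm] at hf
    obtain ⟨_, ⟨i, hi, rfl⟩ | ⟨T, hT, rfl⟩, hle⟩ := exists_le_of_mem_span_monomial hf h
    · have h1 := hle i
      have hne : t ≠ i := fun h => by simp_all; omega
      simp [hne] at h1
    · have := Finsupp.degree_mono hle
      have := hF T hT
      rw [hdeg, Finsupp.degree_single] at *
      omega
  have hJ1 : ∀ f ∈ J, ∀ i : Fin n, coeff (Finsupp.single i 1) f = 0 := by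
    intro f hf i
    by_contra h
    rw [hJm] at hf
    obtain ⟨_, ⟨T, hT, rfl⟩, hle⟩ := exists_le_of_mem_span_monomial hf h
    have := Finsupp.degree_mono hle
    have := hG T hT
    rw [hdeg, Finsupp.degree_single] at *
    omega
  refine csSup_le' ?_
  rintro _ ⟨rs, rfl, hrs, hreg⟩
  by_contra! hlen
  obtain ⟨a, b, c, rs, rfl⟩ : ∃ a b c l, rs = a :: b :: c :: l := by
    match rs, hlen with
    | a :: b :: c :: l, _ => exact ⟨a, b, c, l, rfl⟩
  have ha := hrs a (by simp)
  have hb := hrs b (by simp)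
  have hc := hrs c (by simp)
  have hreg := hreg.toIsWeaklyRegular
  by_cases hcase : ∃ i t : Fin n, (i : ℕ) < r ∧ r ≤ (t : ℕ) ∧ X i * X t ∉ J
  · obtain ⟨i, t, hi, ht, hit⟩ := hcase
    have hAB : Disjoint {i : Fin n | (i : ℕ) < r} {k : Fin n | r ≤ (k : ℕ) ∧ k ≠ t} := by
      rw [Set.disjoint_left]
      intro k hk hk'
      exact absurd hk'.1 (not_le.2 hk)
    obtain ⟨φ, hφ, hφX⟩ := exists_isCocycleOn_quotMod (I := I) (J := J) hAB (X t) hXI (by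
      rintro j hj k ⟨hk, hkt⟩
      rcases lt_or_gt_of_ne hkt with h | h
      · convert h3 j k t hj hk h using 1
        ring
      · convert h3 j t k hj ht h using 1
        ring)
    set P : Ideal (MvPolynomial (Fin n) K) :=
      Ideal.span (X '' ({i : Fin n | (i : ℕ) < r} ∪ {k : Fin n | r ≤ (k : ℕ) ∧ k ≠ t}))
    have hm : Ideal.span (Set.range (X : Fin n → MvPolynomial (Fin n) K)) ≤
        P ⊔ Ideal.span {X t} := by
      rw [Ideal.span_le]
      rintro _ ⟨k, rfl⟩
      by_cases hk : k = t
      · subst hk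
        exact Ideal.mem_sup_right (Ideal.mem_span_singleton_self _)
      · refine Ideal.mem_sup_left (Ideal.subset_span ⟨k, ?_, rfl⟩)
        by_cases hkr : (k : ℕ) < r
        · exact Or.inl hkr
        · exact Or.inr ⟨not_lt.1 hkr, hk⟩
    obtain ⟨ψ, w, hψ, hφψ⟩ := hφ.exists_eq_smul_sub (hm ha) (hm hb) (hm hc) hreg
    obtain ⟨ψ', w', -, hψψ'⟩ := hψ.exists_eq_smul_sub (hm ha) (hm hb) (hm hc) hreg
    have hiP : X i ∈ P := Ideal.subset_span ⟨i, Or.inl hi, rfl⟩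
    have heq := hφψ _ hiP
    rw [hψψ' _ hiP, hφX i hi] at heq
    obtain ⟨⟨w, hw⟩, rfl⟩ := Submodule.Quotient.mk_surjective _ w
    obtain ⟨⟨w', hw'⟩, rfl⟩ := Submodule.Quotient.mk_surjective _ w'
    obtain ⟨⟨v, hv⟩, hv'⟩ := Submodule.Quotient.mk_surjective _ (ψ' (X i))
    rw [← hv'] at heq
    simp only [← Submodule.Quotient.mk_smul, ← Submodule.Quotient.mk_sub] at heq
    rw [Submodule.Quotient.eq] at heq
    change X t * X i - (X i * w - X t * (X i * w' - X t * v)) ∈ J at heq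
    have hmon : monomial (Finsupp.single i 1 + Finsupp.single t 1) (1 : K) = X i * X t := by
      simp [X, monomial_mul]
    rw [← hmon] at hit
    rw [hJm] at heq hit
    have h0 := coeff_eq_zero_of_monomial_notMem heq hit
    have hne : i ≠ t := fun h => by subst h; omega
    have hc1 : coeff (Finsupp.single i 1 + Finsupp.single t 1) (X t * X i : MvPolynomial (Fin n) K)
        = 1 := by
      rw [mul_comm, coeff_X_mul, coeff_X, if_pos rfl]
    have hc2 : coeff (Finsupp.single i 1 + Finsupp.single t 1) (X i * w) = 0 := by
      rw [coeff_X_mul, hI1 w hw t ht]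
    have hc3 : coeff (Finsupp.single i 1) (X i * w') = 0 := by
      rw [← hI0 w' hw', ← coeff_X_mul 0 i w', add_zero]
    have hc4 : coeff (Finsupp.single i 1) (X t * v) = 0 := by
      rw [coeff_X_mul', if_neg]
      simpa using hne.symm
    have hc5 : coeff (Finsupp.single i 1 + Finsupp.single t 1) (X t * (X i * w' - X t * v))
        = 0 := by
      rw [add_comm, coeff_X_mul, coeff_sub, hc3, hc4, sub_zero]
    rw [coeff_sub, coeff_sub, hc1, hc2, hc5] at h0
    simp at h0
  · push Not at hcase
    have hAB : Disjoint {i : Fin n | (i : ℕ) < r} {k : Fin n | r ≤ (k : ℕ)} := by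
      rw [Set.disjoint_left]
      intro k hk hk'
      exact (not_le.2 hk : ¬ r ≤ (k : ℕ)) hk'
    obtain ⟨φ, hφ, hφX⟩ := exists_isCocycleOn_quotMod (I := I) (J := J) hAB 1 hXI (by
      intro i hi k hk
      simpa using hcase i k hi hk)
    have hm : Ideal.span (Set.range (X : Fin n → MvPolynomial (Fin n) K)) ≤
        Ideal.span (X '' ({i : Fin n | (i : ℕ) < r} ∪ {k : Fin n | r ≤ (k : ℕ)})) := by
      rw [← Set.image_univ]
      exact Ideal.span_mono (Set.image_mono fun k _ => lt_or_ge (k : ℕ) r)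
    obtain ⟨z, hz⟩ := hφ.exists_eq_smul (hm ha) (hm hb) hreg
    have hi : ((⟨0, by omega⟩ : Fin n) : ℕ) < r := hr1
    set i : Fin n := ⟨0, by omega⟩
    have heq := hz (X i) (hm (Ideal.subset_span ⟨i, rfl⟩))
    rw [hφX i hi] at heq
    obtain ⟨⟨z, hz'⟩, rfl⟩ := Submodule.Quotient.mk_surjective _ z
    rw [← Submodule.Quotient.mk_smul, Submodule.Quotient.eq] at heq
    change 1 * X i - X i * z ∈ J at heq
    have h0 := hJ1 _ heq i
    have h1 := hI0 z hz'
    have h2 := coeff_X_mul (R := K) 0 i z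
    rw [add_zero] at h2
    simp [h2, h1] at h0
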